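/- (SVRG one-step progress bound.) Let f_1,...,f_n : ℝ^d → ℝ be differentiable functions, each β-smooth, and let F(x) = (1/n)Σ_{i=1}^n f_i(x) be convex, differentiable, and σ-strongly convex, with minimizer x* (so ∇F(x*) = 0). Fix a step size η > 0 and points x, x̃ ∈ ℝ^d. Then (1/n)Σ_{i=1}^n ‖x − η(∇f_i(x) − ∇f_i(x̃) + ∇F(x̃)) − x*‖² ≤ ‖x − x*‖² − 2ησ‖x − x*‖² + 2η²β²(‖x − x*‖² + ‖x̃ − x*‖²). -/

import Mathlib

open scoped InnerProductSpace

section InnerProductSpace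

variable {E : Type*} [NormedAddCommGroup E] [InnerProductSpace ℝ E]

lemma norm_sub_sq_le_two_mul_add (a b : E) : ‖a - b‖ ^ 2 ≤ 2 * ‖a‖ ^ 2 + 2 * ‖b‖ ^ 2 := by
  have h := parallelogram_law_with_norm ℝ a b
  nlinarith [sq_nonneg ‖a + b‖]

/-- The variance of a finite family of vectors is at most its second moment. -/
lemma sum_norm_sub_mean_sq_le {ι : Type*} [Fintype ι] (b : ι → E) (m : E)
    (hm : ∑ i, b i = (Fintype.card ι : ℝ) • m) :
    ∑ i, ‖b i - m‖ ^ 2 ≤ ∑ i, ‖b i‖ ^ 2 := by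
  simp only [norm_sub_sq_real, Finset.sum_add_distrib, Finset.sum_sub_distrib,
    ← Finset.mul_sum, ← sum_inner, hm, real_inner_smul_left, real_inner_self_eq_norm_sq,
    Finset.sum_const, Finset.card_univ, nsmul_eq_mul]
  nlinarith [mul_nonneg (Nat.cast_nonneg (α := ℝ) (Fintype.card ι)) (sq_nonneg ‖m‖)]

variable [CompleteSpace E]

lemma gradient_const_mul_sum {ι : Type*} [Fintype ι] (c : ℝ) {f : ι → E → ℝ}
    (hf : ∀ i, Differentiable ℝ (f i)) (x : E) :
    gradient (fun y => c * ∑ i, f i y) x = c • ∑ i, gradient (f i) x := by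
  have h : HasFDerivAt (fun y => c * ∑ i, f i y) (c • ∑ i, fderiv ℝ (f i) x) x :=
    (HasFDerivAt.fun_sum fun i _ => (hf i x).hasFDerivAt).const_mul c
  simp [gradient, h.fderiv]

lemma gradient_eq_zero_of_forall_le {F : E → ℝ} {z : E} (hz : ∀ y, F z ≤ F y) :
    gradient F z = 0 := by
  have h : IsLocalMin F z := Filter.Eventually.of_forall hz
  simp [gradient, h.fderiv_eq_zero]

lemma mul_norm_sq_le_inner_gradient {F : E → ℝ} {σ : ℝ}
    (hF : ∀ x y, F x + ⟪gradient F x, y - x⟫_ℝ + σ / 2 * ‖x - y‖ ^ 2 ≤ F y)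
    {z : E} (hz : ∀ y, F z ≤ F y) (x : E) :
    σ * ‖x - z‖ ^ 2 ≤ ⟪x - z, gradient F x⟫_ℝ := by
  have h₁ := hF x z
  have h₂ := hF z x
  rw [gradient_eq_zero_of_forall_le hz, inner_zero_left, norm_sub_rev] at h₂
  rw [← neg_sub x z, inner_neg_right, real_inner_comm] at h₁
  linarith

end InnerProductSpace

/-- SVRG one-step progress bound: let `f 1, ..., f n : ℝ^d → ℝ` be differentiable
and `β`-smooth, and let `F = (1/n)·Σᵢ f i` be convex, differentiable and `σ`-strongly convex
with minimizer `x*`. Then for every step size `η > 0` and points `x, x̃`,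
`(1/n)·Σᵢ ‖x − η(∇fᵢ(x) − ∇fᵢ(x̃) + ∇F(x̃)) − x*‖²
  ≤ ‖x − x*‖² − 2ησ‖x − x*‖² + 2η²β²(‖x − x*‖² + ‖x̃ − x*‖²)`. -/
theorem svrg_one_step_progress
    (d n : ℕ) (f : Fin n → EuclideanSpace ℝ (Fin d) → ℝ) (β : ℝ)
    (hdiff : ∀ i, Differentiable ℝ (f i))
    (hsmooth : ∀ i (x y : EuclideanSpace ℝ (Fin d)),
        ‖gradient (f i) x - gradient (f i) y‖ ≤ β * ‖x - y‖)
    (F : EuclideanSpace ℝ (Fin d) → ℝ)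
    (hF : ∀ x, F x = (1 / (n : ℝ)) * ∑ i, f i x)
    (hFconv : ConvexOn ℝ Set.univ F)
    (hFdiff : Differentiable ℝ F)
    (σ : ℝ)
    (hstrong : ∀ x y : EuclideanSpace ℝ (Fin d),
        F x + ⟪gradient F x, y - x⟫_ℝ + σ / 2 * ‖x - y‖ ^ 2 ≤ F y)
    (xstar : EuclideanSpace ℝ (Fin d)) (hmin : ∀ y, F xstar ≤ F y)
    (η : ℝ) (hη : 0 < η)
    (x xt : EuclideanSpace ℝ (Fin d)) :
    (1 / (n : ℝ)) * ∑ i,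
        ‖x - η • (gradient (f i) x - gradient (f i) xt + gradient F xt) - xstar‖ ^ 2
      ≤ ‖x - xstar‖ ^ 2 - 2 * η * σ * ‖x - xstar‖ ^ 2
          + 2 * η ^ 2 * β ^ 2 * (‖x - xstar‖ ^ 2 + ‖xt - xstar‖ ^ 2) := by
  have hgrad (y) : gradient F y = (1 / (n : ℝ)) • ∑ i, gradient (f i) y := by
    rw [funext hF, gradient_const_mul_sum _ hdiff]
  have hzero : gradient F xstar = 0 := gradient_eq_zero_of_forall_le hmin
  have hinner := mul_norm_sq_le_inner_gradient hstrong hmin x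
  rcases Nat.eq_zero_or_pos n with rfl | hn
  · have hσ : σ * ‖x - xstar‖ ^ 2 ≤ 0 := by simpa [hgrad] using hinner
    have hησ := mul_nonneg hη.le (neg_nonneg.2 hσ)
    have hnonneg : 0 ≤ ‖x - xstar‖ ^ 2
        + 2 * η ^ 2 * β ^ 2 * (‖x - xstar‖ ^ 2 + ‖xt - xstar‖ ^ 2) := by positivity
    simp only [Finset.univ_eq_empty, Finset.sum_empty, mul_zero]
    linarith
  have hn' : (0 : ℝ) < n := Nat.cast_pos.2 hn
  have hsum (y) : ∑ i, gradient (f i) y = (n : ℝ) • gradient F y := by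
    rw [hgrad, smul_smul, mul_one_div_cancel hn'.ne', one_smul]
  have hsq (i) (y z : EuclideanSpace ℝ (Fin d)) :
      ‖gradient (f i) y - gradient (f i) z‖ ^ 2 ≤ β ^ 2 * ‖y - z‖ ^ 2 := by
    rw [← mul_pow]
    exact pow_le_pow_left₀ (norm_nonneg _) (hsmooth i y z) 2
  have hsumsq (y) : ∑ i, ‖gradient (f i) y - gradient (f i) xstar‖ ^ 2
      ≤ n * (β ^ 2 * ‖y - xstar‖ ^ 2) := by
    simpa using Finset.sum_le_sum fun i (_ : i ∈ Finset.univ) => hsq i y xstar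
  have hvar := sum_norm_sub_mean_sq_le
    (fun i => gradient (f i) xt - gradient (f i) xstar) (gradient F xt)
    (by rw [Finset.sum_sub_distrib, hsum, hsum, hzero, smul_zero, sub_zero, Fintype.card_fin])
  set v : Fin n → EuclideanSpace ℝ (Fin d) :=
    fun i => gradient (f i) x - gradient (f i) xt + gradient F xt with hv
  have hvsum : ∑ i, v i = (n : ℝ) • gradient F x := by
    simp [hv, Finset.sum_add_distrib, Finset.sum_sub_distrib, hsum, ← Nat.cast_smul_eq_nsmul ℝ]
  have hvsq : ∑ i, ‖v i‖ ^ 2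
      ≤ n * (2 * β ^ 2 * (‖x - xstar‖ ^ 2 + ‖xt - xstar‖ ^ 2)) := by
    have hsplit (i) : ‖v i‖ ^ 2 ≤ 2 * ‖gradient (f i) x - gradient (f i) xstar‖ ^ 2
        + 2 * ‖gradient (f i) xt - gradient (f i) xstar - gradient F xt‖ ^ 2 := by
      have heq : v i = (gradient (f i) x - gradient (f i) xstar)
          - (gradient (f i) xt - gradient (f i) xstar - gradient F xt) := by
        simp only [hv]
        abel
      rw [heq]
      exact norm_sub_sq_le_two_mul_add _ _
    have h := Finset.sum_le_sum fun i (_ : i ∈ Finset.univ) => hsplit i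
    rw [Finset.sum_add_distrib, ← Finset.mul_sum, ← Finset.mul_sum] at h
    linarith [hsumsq x, hsumsq xt]
  have hexpand : ∑ i, ‖x - η • v i - xstar‖ ^ 2 = n * ‖x - xstar‖ ^ 2
      - 2 * η * (n * ⟪x - xstar, gradient F x⟫_ℝ) + η ^ 2 * ∑ i, ‖v i‖ ^ 2 := by
    have hterm (i) : ‖x - η • v i - xstar‖ ^ 2
        = ‖x - xstar‖ ^ 2 - 2 * η * ⟪x - xstar, v i⟫_ℝ + η ^ 2 * ‖v i‖ ^ 2 := by
      rw [sub_right_comm, norm_sub_sq_real, real_inner_smul_right, norm_smul, mul_pow,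
        Real.norm_eq_abs, sq_abs, mul_assoc]
    simp only [hterm, Finset.sum_add_distrib, Finset.sum_sub_distrib, ← Finset.mul_sum,
      ← inner_sum, hvsum, real_inner_smul_right]
    simp
  rw [one_div, inv_mul_le_iff₀ hn', hexpand]
  have h₁ := mul_le_mul_of_nonneg_left hinner (mul_pos hη hn').le
  have h₂ := mul_le_mul_of_nonneg_left hvsq (sq_nonneg η)
  linarith
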